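/- arXiv:2308.02319 — 4 statements merged into one kernel-verified Lean document; each statement's English description precedes it below -/
import Mathlib

section
/- As $x \to \infty$, $\sum_{1 \le n \le x^{1/3}} \sqrt{n^2 + \frac{8x}{n}} = (3 - 2F(0))\, x^{2/3} - 2\sqrt{2x} + \int_1^{x^{1/3}} \frac{t - \frac{4x}{t^2}}{\sqrt{t^2 + \frac{8x}{t}}}\, \{t\}\, dt + O(x^{1/3})$, where the sum ranges over positive integers $n$ with $n \le x^{1/3}$. -/
open Filter Asymptotics

/-- `F y = ∫_y^{1/2} (2 t^{5/2} - t^{-1/2}) / √(1 + t³) dt`. -/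
noncomputable def F (y : ℝ) : ℝ :=
  ∫ t in y..(1 / 2 : ℝ),
    (2 * t ^ ((5 : ℝ) / 2) - t ^ (-(1 : ℝ) / 2)) / Real.sqrt (1 + t ^ 3)

open MeasureTheory in
lemma euler_sum (f f' : ℝ → ℝ) (y : ℝ) (hy : 1 ≤ y)
    (hf : ∀ t ∈ Set.Icc 1 y, HasDerivAt f (f' t) t) (hc : ContinuousOn f' (Set.Icc 1 y)) :
    ∑ n ∈ Finset.Icc 1 ⌊y⌋₊, f n =
      (∫ t in (1:ℝ)..y, f t) + (∫ t in (1:ℝ)..y, f' t * Int.fract t) + f 1 - Int.fract y * f y := by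
  have hu : Set.uIcc 1 y = Set.Icc 1 y := Set.uIcc_of_le hy
  have hfc : ContinuousOn f (Set.Icc 1 y) := fun t ht => (hf t ht).continuousAt.continuousWithinAt
  have hint : IntegrableOn (deriv f) (Set.Icc 1 y) :=
    (hc.integrableOn_Icc).congr_fun (fun t ht => ((hf t ht).deriv).symm) measurableSet_Icc
  have key := sum_mul_eq_sub_sub_integral_mul (fun _ => (1:ℝ)) (f := f) zero_le_one hy
    (fun t ht => (hf t ht).differentiableAt) hint
  rw [← intervalIntegral.integral_of_le hy] at key
  have hfl : ∀ t : ℝ, 1 ≤ t → (⌊t⌋₊ : ℝ) = t - Int.fract t := by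
    intro t ht
    rw [natCast_floor_eq_intCast_floor (by linarith)]
    linarith [Int.floor_add_fract t]
  have hfi : IntervalIntegrable (fun t => f' t * Int.fract t) volume 1 y := by
    have h1 : IntervalIntegrable f' volume 1 y :=
      ContinuousOn.intervalIntegrable (by rwa [hu])
    refine h1.mono_fun (by rw [Set.uIoc_of_le hy]; exact h1.aestronglyMeasurable.mul measurable_fract.aestronglyMeasurable) ?_
    refine Eventually.of_forall fun t => ?_
    simp only [norm_mul]
    have : ‖Int.fract t‖ ≤ 1 := by
      rw [Real.norm_eq_abs, abs_of_nonneg (Int.fract_nonneg t)]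
      exact (Int.fract_lt_one t).le
    nlinarith [norm_nonneg (f' t)]
  have hgi : IntervalIntegrable (fun t => f' t * (t + 1)) volume 1 y :=
    ContinuousOn.intervalIntegrable (by rw [hu]; fun_prop)
  have hffi : IntervalIntegrable f volume 1 y :=
    ContinuousOn.intervalIntegrable (by rwa [hu])
  have e1 : (∫ t in (1:ℝ)..y, deriv f t * ∑ k ∈ Finset.Icc 0 ⌊t⌋₊, (1:ℝ)) =
      (∫ t in (1:ℝ)..y, f' t * (t + 1)) - ∫ t in (1:ℝ)..y, f' t * Int.fract t := by
    rw [← intervalIntegral.integral_sub hgi hfi]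
    apply intervalIntegral.integral_congr
    intro t ht
    rw [hu] at ht
    simp only [(hf t ht).deriv, Finset.sum_const, Nat.card_Icc, nsmul_eq_mul]
    rw [Nat.sub_zero, Nat.cast_add, hfl t ht.1]
    push_cast
    ring
  have e2 : (∫ t in (1:ℝ)..y, (f' t * (t + 1) + f t)) = f y * (y + 1) - f 1 * (1 + 1) := by
    apply intervalIntegral.integral_eq_sub_of_hasDerivAt (f := fun t => f t * (t + 1))
    · intro t ht
      rw [hu] at ht
      have := (hf t ht).mul ((hasDerivAt_id t).add_const 1)
      simp only [id, mul_one] at this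
      exact this
    · exact hgi.add hffi
  rw [intervalIntegral.integral_add hgi hffi] at e2
  rw [e1] at key
  simp only [mul_one, Finset.sum_const, Nat.card_Icc, nsmul_eq_mul, Nat.floor_one] at key
  push_cast at key
  have hs : ∑ n ∈ Finset.Icc 1 ⌊y⌋₊, f n = f 1 + ∑ n ∈ Finset.Ioc 1 ⌊y⌋₊, f n := by
    rw [Finset.Icc_eq_cons_Ioc ((Nat.one_le_floor_iff y).2 hy), Finset.sum_cons]
    simp
  rw [hs, key]
  push_cast
  rw [hfl y hy]
  linarith

lemma rpow52 (u : ℝ) (hu : 0 ≤ u) : u ^ ((5:ℝ)/2) = u ^ 2 * √u := by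
  rw [Real.sqrt_eq_rpow, ← Real.rpow_natCast u 2, ← Real.rpow_add_of_nonneg hu (by norm_num) (by norm_num)]
  norm_num

lemma rpowm12 (u : ℝ) (hu : 0 ≤ u) : u ^ (-(1:ℝ)/2) = (√u)⁻¹ := by
  rw [Real.sqrt_eq_rpow, ← Real.rpow_neg hu]
  norm_num

noncomputable def gI (t : ℝ) : ℝ :=
  (2 * t ^ ((5 : ℝ) / 2) - t ^ (-(1 : ℝ) / 2)) / Real.sqrt (1 + t ^ 3)

open MeasureTheory in
lemma gI_int (a b : ℝ) (ha : 0 ≤ a) (hb : 0 ≤ b) : IntervalIntegrable gI volume a b := by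
  unfold gI
  simp only [div_eq_mul_inv _ (√_)]
  apply IntervalIntegrable.mul_continuousOn
  · apply IntervalIntegrable.sub
    · exact (intervalIntegral.intervalIntegrable_rpow' (by norm_num)).const_mul 2
    · exact intervalIntegral.intervalIntegrable_rpow' (by norm_num)
  · apply ContinuousOn.inv₀ (by fun_prop)
    intro t ht
    have : 0 ≤ t := le_trans (le_min ha hb) ht.1
    positivity

lemma F_small (e : ℝ) (he : 0 < e) (he2 : e ≤ 1/2) : |F e - F 0 - 2 * √e| ≤ 3 * e := by
  have h1 : F 0 = (∫ t in (0:ℝ)..e, gI t) + F e := by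
    unfold F
    exact (intervalIntegral.integral_add_adjacent_intervals (gI_int 0 e le_rfl he.le)
      (gI_int e (1/2) he.le (by norm_num))).symm
  have h2 : ∫ t in (0:ℝ)..e, t ^ (-(1:ℝ)/2) = 2 * √e := by
    rw [integral_rpow (by norm_num), Real.sqrt_eq_rpow]
    norm_num
    ring
  have h3 : ‖∫ t in (0:ℝ)..e, (gI t + t ^ (-(1:ℝ)/2))‖ ≤ 3 * |e - 0| := by
    apply intervalIntegral.norm_integral_le_of_norm_le_const
    intro u hu
    rw [Set.uIoc_of_le he.le] at hu
    obtain ⟨hu0, hu1⟩ := hu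
    unfold gI
    rw [rpow52 u hu0.le, rpowm12 u hu0.le]
    set s := √u with hs
    have hsp : 0 < s := Real.sqrt_pos.2 hu0
    have hsu : s ^ 2 = u := Real.sq_sqrt hu0.le
    have hs1 : s ≤ 1 := by nlinarith
    set q := √(1 + u ^ 3) with hq
    have hq1 : 1 ≤ q := by
      rw [hq]; apply Real.one_le_sqrt.2; have : 0 ≤ u ^ 3 := by positivity
      linarith
    have hqq : q ^ 2 = 1 + u ^ 3 := Real.sq_sqrt (by positivity)
    have hq2 : q - 1 ≤ u ^ 3 := by nlinarith
    have e1 : (2 * (u ^ 2 * s) - s⁻¹) / q + s⁻¹ = (2 * (u ^ 2 * s) + (q - 1) / s) / q := by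
      field_simp; ring
    have h5 : (q - 1) / s ≤ 1 := by
      rw [div_le_one hsp]
      have : u ^ 3 = s ^ 6 := by rw [← hsu]; ring
      have : s ^ 6 ≤ s ^ 1 := pow_le_pow_of_le_one hsp.le hs1 (by norm_num)
      linarith [pow_one s]
    have h6 : 0 ≤ (q - 1) / s := div_nonneg (by linarith) hsp.le
    have h7 : u ^ 2 * s ≤ 1 := by
      have : u ^ 2 ≤ 1 := by nlinarith
      nlinarith
    have h8 : 0 ≤ u ^ 2 * s := by positivity
    rw [e1, Real.norm_eq_abs, abs_of_nonneg (by positivity), div_le_iff₀ (by linarith)]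
    nlinarith
  rw [intervalIntegral.integral_add (gI_int 0 e le_rfl he.le)
    (intervalIntegral.intervalIntegrable_rpow' (by norm_num)), h2, sub_zero, abs_of_pos he,
    Real.norm_eq_abs] at h3
  rw [← abs_neg] at h3
  convert h3 using 2
  linarith

lemma W_int (e : ℝ) (he : 0 < e) (he2 : e ≤ 1/2) :
    ∫ u in e..(1/2:ℝ), 4 * (√(1 + u ^ 3) / √u) = 3 - 4 * √e * √(1 + e ^ 3) - 2 * F e := by
  have hu : Set.uIcc e (1/2) = Set.Icc e (1/2) := Set.uIcc_of_le he2
  have hgi := gI_int e (1/2) he.le (by norm_num)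
  have hhi : IntervalIntegrable (fun u => 4 * (√(1 + u ^ 3) / √u)) MeasureTheory.volume e (1/2) := by
    apply ContinuousOn.intervalIntegrable
    rw [hu]
    apply ContinuousOn.mul (by fun_prop)
    apply ContinuousOn.div (by fun_prop) (by fun_prop)
    intro t ht
    have : 0 < t := lt_of_lt_of_le he ht.1
    positivity
  have h1 : ∫ u in e..(1/2:ℝ), (4 * (√(1 + u ^ 3) / √u) + 2 * gI u) =
      4 * √(1/2) * √(1 + (1/2) ^ 3) - 4 * √e * √(1 + e ^ 3) := by
    apply intervalIntegral.integral_eq_sub_of_hasDerivAt (f := fun u => 4 * √u * √(1 + u ^ 3))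
    · intro u huu
      rw [hu] at huu
      have hu0 : 0 < u := lt_of_lt_of_le he huu.1
      have hd1 := (Real.hasDerivAt_sqrt hu0.ne').const_mul 4
      have hd2 := (((hasDerivAt_id u).pow 3).const_add 1).sqrt (by simp; positivity)
      have hd := hd1.mul hd2
      simp only [id] at hd
      refine hd.congr_deriv ?_
      unfold gI
      rw [rpow52 u hu0.le, rpowm12 u hu0.le]
      have hsp : 0 < √u := Real.sqrt_pos.2 hu0
      have hsu : √u ^ 2 = u := Real.sq_sqrt hu0.le
      have hq : 0 < √(1 + u ^ 3) := by positivity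
      have hqq : √(1 + u ^ 3) ^ 2 = 1 + u ^ 3 := Real.sq_sqrt (by positivity)
      simp
      field_simp
      rw [hqq, hsu]
      ring
    · exact hhi.add (hgi.const_mul 2)
  rw [intervalIntegral.integral_add hhi (hgi.const_mul 2), intervalIntegral.integral_const_mul 2] at h1
  have h2 : √(1/2) * √(1 + (1/2) ^ 3) = 3/4 := by
    rw [← Real.sqrt_mul (by norm_num)]
    rw [show (1/2 * (1 + (1/2)^3) : ℝ) = (3/4)^2 by norm_num]
    exact Real.sqrt_sq (by norm_num)
  have h3 : ∫ u in e..(1/2:ℝ), gI u = F e := rfl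
  rw [h3] at h1
  linarith

lemma sub_int (y : ℝ) (hy : 1 ≤ y) :
    ∫ t in (1:ℝ)..y, √(t ^ 2 + 8 * y ^ 3 / t) =
      y ^ 2 * ∫ u in (1/(2*y))..(1/2:ℝ), 4 * (√(1 + u ^ 3) / √u) := by
  have hy0 : 0 < y := by linarith
  have h := intervalIntegral.integral_comp_div (a := 1) (b := y)
    (fun u => 4 * (√(1 + u ^ 3) / √u)) (c := 2 * y) (by positivity)
  rw [show y / (2 * y) = 1 / 2 by field_simp] at h
  have h2 : ∫ t in (1:ℝ)..y, √(t ^ 2 + 8 * y ^ 3 / t) =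
      ∫ t in (1:ℝ)..y, (y / 2) * (4 * (√(1 + (t / (2 * y)) ^ 3) / √(t / (2 * y)))) := by
    apply intervalIntegral.integral_congr
    intro t ht
    rw [Set.uIcc_of_le hy] at ht
    have ht0 : 0 < t := by linarith [ht.1]
    simp only
    rw [← Real.sqrt_div (by positivity)]
    rw [show t ^ 2 + 8 * y ^ 3 / t = (2 * y) ^ 2 * ((1 + (t / (2 * y)) ^ 3) / (t / (2 * y))) by
      field_simp; ring]
    rw [Real.sqrt_mul (by positivity), Real.sqrt_sq (by positivity)]
    ring
  rw [h2, intervalIntegral.integral_const_mul, h, smul_eq_mul]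
  ring

lemma main_bound (y : ℝ) (hy : 1 ≤ y) :
    |(∑ n ∈ Finset.Icc 1 ⌊y⌋₊, √((n : ℝ) ^ 2 + 8 * y ^ 3 / n))
          - ((3 - 2 * F 0) * y ^ 2 - 2 * √(2 * y ^ 3)
              + ∫ t in (1 : ℝ)..y,
                  (t - 4 * y ^ 3 / t ^ 2) / √(t ^ 2 + 8 * y ^ 3 / t) * Int.fract t)| ≤ 20 * y := by
  have hy0 : 0 < y := by linarith
  have hpos : ∀ t ∈ Set.Icc 1 y, 0 < t ∧ 0 < t ^ 2 + 8 * y ^ 3 / t := fun t ht => by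
    have : 0 < t := by linarith [ht.1]
    exact ⟨this, by positivity⟩
  have hE := euler_sum (fun t => √(t ^ 2 + 8 * y ^ 3 / t))
    (fun t => (t - 4 * y ^ 3 / t ^ 2) / √(t ^ 2 + 8 * y ^ 3 / t)) y hy
    (by
      intro t ht
      obtain ⟨h0, h1⟩ := hpos t ht
      have hd := (((hasDerivAt_id t).pow 2).add
        ((hasDerivAt_const t (8 * y ^ 3)).div (hasDerivAt_id t) h0.ne')).sqrt (by simpa using h1.ne')
      refine HasDerivAt.congr_deriv hd ?_
      simp
      have : 0 < √(t ^ 2 + 8 * y ^ 3 / t) := by positivity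
      field_simp
      ring)
    (by
      apply ContinuousOn.div
      · apply ContinuousOn.sub (by fun_prop)
        apply ContinuousOn.div (by fun_prop) (by fun_prop)
        intro t ht
        have := (hpos t ht).1
        positivity
      · apply ContinuousOn.sqrt
        apply ContinuousOn.add (by fun_prop)
        apply ContinuousOn.div (by fun_prop) (by fun_prop)
        intro t ht
        exact (hpos t ht).1.ne'
      · intro t ht
        exact (Real.sqrt_pos.2 (hpos t ht).2).ne')
  rw [hE, sub_int y hy]
  set e := 1 / (2 * y) with he
  have he0 : 0 < e := by positivity
  have hey : e * y = 1 / 2 := by rw [he]; field_simp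
  have he2 : e ≤ 1 / 2 := by nlinarith
  rw [W_int e he0 he2]
  have hF := abs_le.1 (F_small e he0 he2)
  set s := √e with hs
  have hs0 : 0 < s := Real.sqrt_pos.2 he0
  have hss : s ^ 2 = e := Real.sq_sqrt he0.le
  have hr : √(2 * y ^ 3) = 2 * y ^ 2 * s := by
    rw [show 2 * y ^ 3 = (2 * y ^ 2) ^ 2 * e by linear_combination (-4 * y ^ 3) * hey]
    rw [Real.sqrt_mul (by positivity), Real.sqrt_sq (by positivity)]
  have hfy : √(y ^ 2 + 8 * y ^ 3 / y) = 3 * y := by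
    rw [show y ^ 2 + 8 * y ^ 3 / y = (3 * y) ^ 2 by field_simp; ring]
    exact Real.sqrt_sq (by positivity)
  rw [hfy, hr]
  have hf1 : |√(1 ^ 2 + 8 * y ^ 3 / 1) - 4 * y ^ 2 * s| ≤ 1 := by
    rw [show 4 * y ^ 2 * s = 2 * √(2 * y ^ 3) by rw [hr]; ring]
    set r := √(2 * y ^ 3)
    have hr0 : 0 ≤ r := Real.sqrt_nonneg _
    have hrr : r ^ 2 = 2 * y ^ 3 := Real.sq_sqrt (by positivity)
    rw [abs_le]
    constructor
    · have : 2 * r ≤ √(1 ^ 2 + 8 * y ^ 3 / 1) := Real.le_sqrt_of_sq_le (by nlinarith)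
      linarith
    · have : √(1 ^ 2 + 8 * y ^ 3 / 1) ≤ 2 * r + 1 := Real.sqrt_le_iff.2 ⟨by linarith, by nlinarith⟩
      linarith
  have hf1 := abs_le.1 hf1
  set p := √(1 ^ 2 + 8 * y ^ 3 / 1)
  set q := √(1 + e ^ 3) with hq
  have hq1 : 1 ≤ q := by
    rw [hq]; apply Real.one_le_sqrt.2; have : 0 ≤ e ^ 3 := by positivity
    linarith
  have hqq : q ^ 2 = 1 + e ^ 3 := Real.sq_sqrt (by positivity)
  have hq2 : q - 1 ≤ e ^ 3 := by nlinarith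
  have hs1 : s ≤ 1 := by nlinarith
  -- W bound
  have hW0 : 0 ≤ y ^ 2 * (s * (q - 1)) := mul_nonneg (by positivity) (mul_nonneg hs0.le (by linarith))
  have hW1 : y ^ 2 * (s * (q - 1)) ≤ 1 := by
    have h1 : s * (q - 1) ≤ e ^ 3 := by nlinarith
    have h2 : y ^ 2 * e ^ 3 = 1 / 4 * e := by
      linear_combination (e * (e * y + 1/2)) * hey
    have := mul_le_mul_of_nonneg_left h1 (sq_nonneg y)
    linarith
  set D := F e - F 0 - 2 * s with hD
  have hD1 : y ^ 2 * D ≤ 3 / 2 * y := by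
    have := mul_le_mul_of_nonneg_left hF.2 (sq_nonneg y)
    have h2 : y ^ 2 * (3 * e) = 3 / 2 * y := by linear_combination (3 * y) * hey
    linarith
  have hD2 : -(3 / 2 * y) ≤ y ^ 2 * D := by
    have := mul_le_mul_of_nonneg_left hF.1 (sq_nonneg y)
    have h2 : y ^ 2 * (3 * e) = 3 / 2 * y := by linear_combination (3 * y) * hey
    linarith
  have hfr0 : 0 ≤ Int.fract y * (3 * y) := mul_nonneg (Int.fract_nonneg y) (by positivity)
  have hfr1 : Int.fract y * (3 * y) ≤ 3 * y := by nlinarith [Int.fract_lt_one y]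
  have hFe : F e = D + F 0 + 2 * s := by rw [hD]; ring
  rw [hFe]
  generalize (∫ t in (1:ℝ)..y, (t - 4 * y ^ 3 / t ^ 2) / √(t ^ 2 + 8 * y ^ 3 / t) * Int.fract t) = J
  have : y ^ 2 * (3 - 4 * s * q - 2 * (D + F 0 + 2 * s)) + J + p - Int.fract y * (3 * y) -
      ((3 - 2 * F 0) * y ^ 2 - 2 * (2 * y ^ 2 * s) + J) =
      -4 * (y ^ 2 * (s * (q - 1))) - 2 * (y ^ 2 * D) + (p - 4 * y ^ 2 * s) - Int.fract y * (3 * y) := by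
    ring
  rw [this, abs_le]
  constructor <;> linarith [hf1.1, hf1.2]

theorem sqrt_sum_with_fract_integral :
    (fun x : ℝ =>
        (∑ n ∈ Finset.Icc 1 ⌊x ^ ((1 : ℝ) / 3)⌋₊,
            Real.sqrt ((n : ℝ) ^ 2 + 8 * x / n))
          - ((3 - 2 * F 0) * x ^ ((2 : ℝ) / 3) - 2 * Real.sqrt (2 * x)
              + ∫ t in (1 : ℝ)..x ^ ((1 : ℝ) / 3),
                  (t - 4 * x / t ^ 2) / Real.sqrt (t ^ 2 + 8 * x / t) * Int.fract t))
      =O[atTop] fun x : ℝ => x ^ ((1 : ℝ) / 3) := by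
  apply IsBigO.of_bound 20
  filter_upwards [eventually_ge_atTop 1] with x hx
  have hx0 : 0 ≤ x := by linarith
  have hy : 1 ≤ x ^ ((1:ℝ)/3) := Real.one_le_rpow hx (by norm_num)
  have h3 : (x ^ ((1:ℝ)/3)) ^ 3 = x := by
    rw [← Real.rpow_natCast, ← Real.rpow_mul hx0]; norm_num
  have h2 : (x ^ ((1:ℝ)/3)) ^ 2 = x ^ ((2:ℝ)/3) := by
    rw [← Real.rpow_natCast, ← Real.rpow_mul hx0]; norm_num
  have := main_bound _ hy
  rw [h3, h2] at this
  rw [Real.norm_eq_abs, Real.norm_eq_abs, abs_of_nonneg (by linarith : 0 ≤ x ^ ((1:ℝ)/3))]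
  exact this
end

section
/- As $x \to \infty$, $\int_1^{x^{1/3}} \frac{\{t\}}{t^{3/2}\sqrt{1 + \frac{t^3}{8x}}}\, dt = -2 - 2\zeta\left(\frac{1}{2}\right) + O(x^{-1/6})$, where $\zeta$ denotes the Riemann zeta function (analytically continued, so $\zeta(1/2)$ is its value at $1/2$). -/
open Filter Asymptotics

open MeasureTheory Set in
lemma fz_f_locInt : LocallyIntegrableOn
    ((Ioi (1:ℝ)).indicator (fun t : ℝ => ((Int.fract t : ℝ) : ℂ))) (Ioi 0) := by
  have h1 : Measurable ((Ioi (1:ℝ)).indicator (fun t : ℝ => ((Int.fract t : ℝ) : ℂ))) :=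
    (Complex.measurable_ofReal.comp measurable_fract).indicator measurableSet_Ioi
  have h2 : LocallyIntegrable (fun _ : ℝ => (1:ℝ)) volume := locallyIntegrable_const 1
  refine (h2.mono h1.aestronglyMeasurable (Eventually.of_forall fun t => ?_)).locallyIntegrableOn _
  refine (norm_indicator_le_norm_self _ _).trans ?_
  rw [Complex.norm_real, Real.norm_of_nonneg (Int.fract_nonneg t)]
  simpa using (Int.fract_lt_one t).le

open MeasureTheory Set in
lemma fz_f_top : ((Ioi (1:ℝ)).indicator (fun t : ℝ => ((Int.fract t : ℝ) : ℂ)))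
    =O[atTop] (fun t : ℝ => t ^ (-(0:ℝ))) := by
  refine IsBigO.of_bound 1 (Eventually.of_forall fun t => ?_)
  refine (norm_indicator_le_norm_self _ _).trans ?_
  rw [Complex.norm_real, Real.norm_of_nonneg (Int.fract_nonneg t)]
  simpa using (Int.fract_lt_one t).le

open MeasureTheory Set in
lemma fz_f_bot (b : ℝ) : ((Ioi (1:ℝ)).indicator (fun t : ℝ => ((Int.fract t : ℝ) : ℂ)))
    =O[nhdsWithin 0 (Ioi 0)] (fun t : ℝ => t ^ (-b)) := by
  refine IsBigO.of_bound 1 ?_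
  have : ∀ᶠ t : ℝ in nhdsWithin 0 (Ioi 0), t < 1 :=
    (eventually_lt_nhds one_pos).filter_mono nhdsWithin_le_nhds
  filter_upwards [this] with t ht
  rw [indicator_of_notMem (by simp [ht.le])]
  simp

/-- The Mellin side. -/
noncomputable def fzG (s : ℂ) : ℂ :=
  mellin ((Set.Ioi (1:ℝ)).indicator (fun t : ℝ => ((Int.fract t : ℝ) : ℂ))) (-s)

open MeasureTheory Set in
lemma fzG_eq (s : ℂ) : fzG s = ∫ t in Ioi (1:ℝ), (t:ℂ) ^ (-(s+1)) * ((Int.fract t : ℝ) : ℂ) := by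
  rw [fzG, mellin]
  have : ∀ t : ℝ, (t:ℂ) ^ (-s-1) • ((Ioi (1:ℝ)).indicator (fun t : ℝ => ((Int.fract t : ℝ) : ℂ))) t
      = (Ioi (1:ℝ)).indicator (fun t : ℝ => (t:ℂ) ^ (-(s+1)) * ((Int.fract t : ℝ) : ℂ)) t := by
    intro t
    by_cases h : t ∈ Ioi (1:ℝ)
    · rw [indicator_of_mem h, indicator_of_mem h, smul_eq_mul]; ring_nf
    · rw [indicator_of_notMem h, indicator_of_notMem h, smul_zero]
  simp_rw [this]
  rw [setIntegral_indicator measurableSet_Ioi]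
  congr 2
  exact inter_eq_right.2 (Ioi_subset_Ioi zero_le_one)

lemma fzG_diff {s : ℂ} (hs : 0 < s.re) : DifferentiableAt ℂ fzG s := by
  have := mellin_differentiableAt_of_isBigO_rpow (s := -s) fz_f_locInt fz_f_top (by simpa using hs)
    (fz_f_bot ((-s).re - 1)) (by linarith)
  exact DifferentiableAt.comp s this differentiableAt_id.neg

open MeasureTheory Set in
lemma fz_int {s : ℂ} (hs : 0 < s.re) :
    IntegrableOn (fun t : ℝ => (t:ℂ) ^ (-(s+1)) * ((Int.fract t : ℝ) : ℂ)) (Ioi 1) := by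
  refine Integrable.mul_bdd (c := 1) (integrableOn_Ioi_cpow_of_lt (by simp; linarith) one_pos) ?_ ?_
  · exact (Complex.measurable_ofReal.comp measurable_fract).aestronglyMeasurable
  · refine Eventually.of_forall fun t => ?_
    rw [Complex.norm_real, Real.norm_of_nonneg (Int.fract_nonneg t)]
    exact (Int.fract_lt_one t).le

open MeasureTheory Set in
lemma fz_zeta {s : ℂ} (hs : 1 < s.re) : riemannZeta s = s / (s - 1) - s * fzG s := by
  have hne : s - 1 ≠ 0 := by
    intro h
    have := congrArg Complex.re h
    simp at this; linarith
  have h := LSeries_eq_mul_integral (1 : ℕ → ℂ) zero_le_one hs (LSeriesSummable_one_iff.2 hs)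
    (IsBigO.of_bound 1 (Eventually.of_forall fun n => by simp))
  rw [LSeries_one_eq_riemannZeta hs] at h
  have hi := integral_Ioi_cpow_of_lt (a := -s) (by simpa using hs) one_pos
  have hii := integrableOn_Ioi_cpow_of_lt (a := -s) (by simpa using hs) one_pos
  have : ∫ t in Ioi (1:ℝ), (∑ k ∈ Finset.Icc 1 ⌊t⌋₊, (1 : ℕ → ℂ) k) * (t:ℂ) ^ (-(s+1))
      = ∫ t in Ioi (1:ℝ), ((t:ℂ) ^ (-s) - (t:ℂ) ^ (-(s+1)) * ((Int.fract t : ℝ) : ℂ)) := by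
    refine setIntegral_congr_fun measurableSet_Ioi fun t ht => ?_
    have ht0 : (0:ℝ) < t := one_pos.trans ht
    have e1 : (t:ℂ) ^ (-s) = (t:ℂ) ^ (-(s+1)) * t := by
      have := Complex.cpow_add (x := (t:ℂ)) (-(s+1)) 1 (by exact_mod_cast ht0.ne')
      rw [Complex.cpow_one] at this
      rw [← this]; ring_nf
    have e2 : (∑ k ∈ Finset.Icc 1 ⌊t⌋₊, (1 : ℕ → ℂ) k) = (t:ℂ) - ((Int.fract t : ℝ) : ℂ) := by
      have : ((⌊t⌋₊ : ℕ) : ℝ) = t - Int.fract t := by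
        rw [natCast_floor_eq_intCast_floor ht0.le, Int.self_sub_fract]
      rw [← Complex.ofReal_sub, ← this]; simp
    simp only [e2]
    rw [e1]; ring
  rw [this, integral_sub hii (fz_int (by linarith)), ← fzG_eq, hi] at h
  rw [h]
  have h2 : -s + 1 ≠ 0 := by intro h; apply hne; linear_combination -h
  simp
  field_simp
  ring

lemma fz_half : fzG (1/2) = -2 - 2 * riemannZeta (1/2) := by
  have hU : IsPreconnected {s : ℂ | 0 < s.re} :=
    (convex_halfSpace_re_gt 0).isPreconnected
  have hO : IsOpen {s : ℂ | 0 < s.re} := isOpen_lt continuous_const Complex.continuous_re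
  have h1 : AnalyticOnNhd ℂ riemannZeta₁ {s : ℂ | 0 < s.re} :=
    differentiable_riemannZeta₁.differentiableOn.analyticOnNhd hO
  have h2 : AnalyticOnNhd ℂ (fun s => s - s * (s-1) * fzG s) {s : ℂ | 0 < s.re} := by
    refine DifferentiableOn.analyticOnNhd (fun s hs => ?_) hO
    have := fzG_diff hs
    exact DifferentiableAt.differentiableWithinAt (by fun_prop)
  have key := h1.eqOn_of_preconnected_of_eventuallyEq h2 hU (z₀ := 2) (by simp) (by
    have : ∀ᶠ s : ℂ in nhds 2, 1 < s.re :=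
      (isOpen_lt continuous_const Complex.continuous_re).mem_nhds (by simp)
    filter_upwards [this] with s hs
    have hne : s ≠ 1 := by rintro rfl; simp at hs
    have hne' : s - 1 ≠ 0 := sub_ne_zero.2 hne
    have := riemannZeta_eq_inv_sub_mul hne
    rw [fz_zeta hs] at this
    field_simp at this
    linear_combination -this)
  have hk := key (show (1/2 : ℂ) ∈ {s : ℂ | 0 < s.re} by simp)
  have hz := riemannZeta_eq_inv_sub_mul (s := 1/2) (by norm_num)
  simp only at hk
  rw [hk] at hz
  rw [hz]
  norm_num
  ring

open MeasureTheory Set in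
lemma fz_real : ((∫ t in Ioi (1:ℝ), Int.fract t / t ^ ((3:ℝ)/2) : ℝ) : ℂ)
    = -2 - 2 * riemannZeta (1/2) := by
  rw [← fz_half, fzG_eq, ← integral_complex_ofReal]
  refine setIntegral_congr_fun measurableSet_Ioi fun t ht => ?_
  have ht0 : (0:ℝ) < t := one_pos.trans ht
  have : (t:ℂ) ^ (-((1/2:ℂ)+1)) = ((t ^ (-((3:ℝ)/2)) : ℝ) : ℂ) := by
    rw [Complex.ofReal_cpow ht0.le]; congr 1; push_cast; norm_num
  simp only [this]
  rw [Real.rpow_neg ht0.le]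
  push_cast
  rw [div_eq_mul_inv, mul_comm]

open MeasureTheory Set in
lemma fz_rint (c : ℝ) (hc : 0 < c) : IntegrableOn (fun t : ℝ => Int.fract t / t ^ ((3:ℝ)/2)) (Ioi c) := by
  have h := integrableOn_Ioi_rpow_of_lt (a := -((3:ℝ)/2)) (by norm_num) hc
  have := Integrable.mul_bdd (c := 1) (g := fun t : ℝ => Int.fract t) h
    measurable_fract.aestronglyMeasurable
    (Eventually.of_forall fun t => by
      rw [Real.norm_of_nonneg (Int.fract_nonneg t)]; exact (Int.fract_lt_one t).le)
  refine IntegrableOn.congr_fun this (fun t ht => ?_) measurableSet_Ioi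
  have ht0 : (0:ℝ) < t := hc.trans ht
  change t ^ (-((3:ℝ)/2)) * Int.fract t = _
  rw [Real.rpow_neg ht0.le]
  exact (div_eq_inv_mul _ _).symm

open MeasureTheory Set in
lemma fz_tail (c : ℝ) (hc : 0 < c) :
    |∫ t in Ioi c, Int.fract t / t ^ ((3:ℝ)/2)| ≤ 2 * c ^ (-(1:ℝ)/2) := by
  have h := integrableOn_Ioi_rpow_of_lt (a := -((3:ℝ)/2)) (by norm_num) hc
  have e := integral_Ioi_rpow_of_lt (a := -((3:ℝ)/2)) (by norm_num) hc
  rw [abs_of_nonneg]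
  · calc _ ≤ ∫ t in Ioi c, t ^ (-((3:ℝ)/2)) := by
          refine setIntegral_mono_on (fz_rint c hc) h measurableSet_Ioi fun t ht => ?_
          have ht0 : (0:ℝ) < t := hc.trans ht
          rw [Real.rpow_neg ht0.le, ← one_div]
          gcongr
          exact (Int.fract_lt_one t).le
      _ = _ := by
          rw [e]; norm_num; ring
  · refine setIntegral_nonneg measurableSet_Ioi fun t ht => ?_
    have ht0 : (0:ℝ) < t := hc.trans ht
    have := Int.fract_nonneg t
    positivity

lemma fz_sqrt (u : ℝ) (hu : 0 ≤ u) : |1 / Real.sqrt (1 + u) - 1| ≤ u := by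
  have h1 : 1 ≤ Real.sqrt (1+u) := Real.one_le_sqrt.2 (by linarith)
  have h2 : Real.sqrt (1+u) ≤ 1 + u := Real.sqrt_le_iff.2 ⟨by linarith, by nlinarith⟩
  have h3 : 1 / Real.sqrt (1+u) ≤ 1 := by rw [div_le_one (by linarith)]; exact h1
  have h4 : 1 - u ≤ 1 / Real.sqrt (1+u) := by
    rw [le_div_iff₀ (by linarith)]
    nlinarith
  rw [abs_le]; constructor <;> linarith

lemma fz_pt (x X t : ℝ) (hx : 0 < x) (ht : 0 < t) (htX : t ≤ X) :
    |Int.fract t / (t ^ ((3 : ℝ) / 2) * Real.sqrt (1 + t ^ 3 / (8 * x)))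
      - Int.fract t / t ^ ((3:ℝ)/2)| ≤ X ^ ((3:ℝ)/2) / x := by
  have h := fz_sqrt (t ^ 3 / (8 * x)) (by positivity)
  have h0 := Int.fract_nonneg t
  have h1 := (Int.fract_lt_one t).le
  have hp : 0 < t ^ ((3:ℝ)/2) := by positivity
  have h3 : t ^ 3 = t ^ ((3:ℝ)/2) * t ^ ((3:ℝ)/2) := by
    rw [← Real.rpow_add ht]; norm_num
  have e : Int.fract t / (t ^ ((3 : ℝ) / 2) * Real.sqrt (1 + t ^ 3 / (8 * x)))
      - Int.fract t / t ^ ((3:ℝ)/2)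
      = Int.fract t / t ^ ((3:ℝ)/2) * (1 / Real.sqrt (1 + t ^ 3 / (8 * x)) - 1) := by
    rw [mul_sub, div_mul_div_comm]; simp
  rw [e, abs_mul, abs_of_nonneg (by positivity)]
  calc _ ≤ 1 / t ^ ((3:ℝ)/2) * (t ^ 3 / (8 * x)) := by gcongr
    _ = t ^ ((3:ℝ)/2) / (8 * x) := by rw [h3]; field_simp
    _ ≤ X ^ ((3:ℝ)/2) / (8 * x) := by gcongr
    _ ≤ _ := by
      have : 0 < X := ht.trans_le htX
      gcongr; linarith

open MeasureTheory Set in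
theorem fract_integral_zeta_half :
    (fun x : ℝ =>
        ((∫ t in (1 : ℝ)..x ^ ((1 : ℝ) / 3),
            Int.fract t / (t ^ ((3 : ℝ) / 2) * Real.sqrt (1 + t ^ 3 / (8 * x))) : ℝ) : ℂ)
          - (-2 - 2 * riemannZeta (1 / 2)))
      =O[atTop] fun x : ℝ => x ^ (-(1 : ℝ) / 6) := by
  refine IsBigO.of_bound 3 ?_
  filter_upwards [eventually_ge_atTop 1] with x hx
  have hx0 : 0 < x := by linarith
  rw [← fz_real, ← Complex.ofReal_sub, Complex.norm_real]
  rw [Real.norm_of_nonneg (r := x ^ (-(1:ℝ)/6)) (by positivity), Real.norm_eq_abs]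
  obtain ⟨X, hX⟩ : ∃ X, X = x ^ ((1:ℝ)/3) := ⟨_, rfl⟩
  rw [← hX]
  have hX1 : 1 ≤ X := by rw [hX]; exact Real.one_le_rpow hx (by norm_num)
  have hX0 : 0 < X := by linarith
  have hh := fz_rint 1 one_pos
  have hhi : IntervalIntegrable (fun t : ℝ => Int.fract t / t ^ ((3:ℝ)/2)) volume 1 X := by
    rw [intervalIntegrable_iff_integrableOn_Ioc_of_le hX1]
    exact hh.mono_set Ioc_subset_Ioi_self
  have hgi : IntervalIntegrable (fun t : ℝ =>
      Int.fract t / (t ^ ((3 : ℝ) / 2) * Real.sqrt (1 + t ^ 3 / (8 * x)))) volume 1 X := by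
    rw [intervalIntegrable_iff_integrableOn_Ioc_of_le hX1] at hhi ⊢
    refine Integrable.mono hhi ?_ ?_
    · refine Measurable.aestronglyMeasurable ?_
      have := measurable_fract (R := ℝ)
      fun_prop
    · refine (ae_restrict_iff' measurableSet_Ioc).2 (Eventually.of_forall fun t ht => ?_)
      have ht0 : (0:ℝ) < t := one_pos.trans ht.1
      have h0 := Int.fract_nonneg t
      rw [Real.norm_of_nonneg (by positivity), Real.norm_of_nonneg (by positivity)]
      gcongr
      refine le_mul_of_one_le_right (by positivity) (Real.one_le_sqrt.2 ?_)
      have : 0 ≤ t ^ 3 / (8 * x) := by positivity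
      linarith
  rw [← intervalIntegral.integral_interval_add_Ioi hh (fz_rint X hX0), ← sub_sub,
    ← intervalIntegral.integral_sub hgi hhi]
  have b1 := intervalIntegral.norm_integral_le_of_norm_le_const (a := 1) (b := X)
    (C := X ^ ((3:ℝ)/2) / x) (f := fun t : ℝ =>
      Int.fract t / (t ^ ((3 : ℝ) / 2) * Real.sqrt (1 + t ^ 3 / (8 * x)))
      - Int.fract t / t ^ ((3:ℝ)/2)) (fun t ht => by
        rw [uIoc_of_le hX1] at ht
        exact fz_pt x X t hx0 (one_pos.trans ht.1) ht.2)
  have b2 := fz_tail X hX0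
  have e2 : X ^ (-(1:ℝ)/2) = x ^ (-(1:ℝ)/6) := by
    rw [hX, ← Real.rpow_mul hx0.le]; norm_num
  have e1 : X ^ ((3:ℝ)/2) / x * |X - 1| ≤ x ^ (-(1:ℝ)/6) := by
    rw [abs_of_nonneg (by linarith)]
    calc _ ≤ X ^ ((3:ℝ)/2) / x * X := by gcongr; linarith
      _ = x ^ ((1:ℝ)/2) / x ^ (1:ℝ) * x ^ ((1:ℝ)/3) := by
        rw [hX, ← Real.rpow_mul hx0.le, Real.rpow_one]; norm_num
      _ = _ := by
        rw [← Real.rpow_sub hx0, ← Real.rpow_add hx0]; norm_num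
  rw [e2] at b2
  rw [Real.norm_eq_abs] at b1
  refine (abs_sub _ _).trans ?_
  linarith
end

section
/- $\int_0^{1/2} \frac{2t^{5/2} - t^{-1/2}}{\sqrt{1+t^3}}\, dt = \frac{3}{4} - \frac{2^{2/3}\sqrt{3}\,\Gamma\left(\frac{1}{3}\right)^3}{8\pi}$. -/
open MeasureTheory Set

lemma aux_beta :
    ∫ x in Ioo (0:ℝ) 1, x ^ (-(5:ℝ)/6) * (1 - x) ^ (-(2:ℝ)/3)
      = Real.Gamma (1/6) * Real.Gamma (1/3) / Real.Gamma (1/2) := by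
  have h := ProbabilityTheory.beta_eq_betaIntegralReal (1/6) (1/3) (by norm_num) (by norm_num)
  have h2 : Complex.betaIntegral ((1/6 : ℝ) : ℂ) ((1/3 : ℝ) : ℂ)
      = ((∫ x in (0:ℝ)..1, x ^ (-(5:ℝ)/6) * (1 - x) ^ (-(2:ℝ)/3) : ℝ) : ℂ) := by
    rw [Complex.betaIntegral, ← intervalIntegral.integral_ofReal]
    apply intervalIntegral.integral_congr
    intro x hx
    rw [uIcc_of_le zero_le_one] at hx
    simp only
    rw [Complex.ofReal_mul, Complex.ofReal_cpow hx.1, Complex.ofReal_cpow (sub_nonneg.2 hx.2)]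
    push_cast
    norm_num
  rw [h2, Complex.ofReal_re, intervalIntegral.integral_of_le zero_le_one,
    integral_Ioc_eq_integral_Ioo] at h
  rw [← h, ProbabilityTheory.beta]
  norm_num

lemma aux_gamma : Real.Gamma (1/6) * Real.Gamma (1/3) / Real.Gamma (1/2)
    = (2:ℝ) ^ ((2:ℝ)/3) * Real.sqrt 3 * (Real.Gamma (1 / 3)) ^ 3 / (2 * Real.pi) := by
  have h1 := Real.Gamma_mul_Gamma_add_half (1/6)
  have h2 := Real.Gamma_mul_Gamma_one_sub (1/3)
  have e1 : (1/6 + 1/2 : ℝ) = 2/3 := by norm_num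
  have e2 : (2 * (1/6) : ℝ) = 1/3 := by norm_num
  have e3 : (1 - 1/3 : ℝ) = 2/3 := by norm_num
  have e4 : Real.pi * (1/3) = Real.pi / 3 := by ring
  rw [e1, e2, e3] at h1
  rw [e3, e4, Real.sin_pi_div_three] at h2
  rw [Real.Gamma_one_half_eq]
  have hp : 0 < √Real.pi := Real.sqrt_pos.2 Real.pi_pos
  have h3 : 0 < √(3:ℝ) := by positivity
  have hg : 0 < Real.Gamma (2/3) := Real.Gamma_pos_of_pos (by norm_num)
  have hg1 : 0 < Real.Gamma (1/3) := Real.Gamma_pos_of_pos (by norm_num)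
  have hpi := Real.pi_pos
  have h2' : Real.Gamma (1/3) * Real.Gamma (2/3) * √3 = 2 * Real.pi := by
    rw [h2]; field_simp
  rw [div_eq_div_iff hp.ne' (by positivity), ← h2']
  linear_combination (Real.Gamma (1/3)^2 * √3) * h1

lemma aux_W {t : ℝ} (h0 : 0 ≤ t) (h1 : t ≤ 1/2) : 0 < 1 + 20 * t^3 - 8 * t^6 := by
  have : t^3 ≤ (1/2)^3 := by gcongr
  have h : 0 ≤ t^3 := by positivity
  nlinarith

lemma aux_C {t : ℝ} (h0 : 0 ≤ t) (h1 : t < 1/2) : 0 < 1 - 8 * t^3 := by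
  have : t^3 < (1/2)^3 := by gcongr
  linarith

noncomputable def phi (t : ℝ) : ℝ := (4 * t * (1 + t^3))^3 / (1 + 20 * t^3 - 8 * t^6)^2

lemma phi_deriv {t : ℝ} (h0 : 0 ≤ t) (h1 : t ≤ 1/2) :
    HasDerivAt phi (192 * t^2 * (1+t^3)^2 * (1 - 8 * t^3)^2 / (1 + 20 * t^3 - 8 * t^6)^3) t := by
  have hW := aux_W h0 h1
  have hn : HasDerivAt (fun t : ℝ => (4 * t * (1 + t^3))^3)
      (3 * (4 * t * (1+t^3))^2 * (4 + 16 * t^3)) t := by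
    have hb : HasDerivAt (fun t : ℝ => 4 * t * (1 + t^3)) (4 + 16 * t^3) t := by
      have := (((hasDerivAt_id' t).const_mul (4:ℝ)).mul ((hasDerivAt_pow 3 t).const_add 1))
      convert! this using 1
      norm_num; ring
    convert! hb.pow 3 using 1
    
  have hd : HasDerivAt (fun t : ℝ => (1 + 20 * t^3 - 8 * t^6)^2)
      (2 * (1 + 20 * t^3 - 8 * t^6) * (60 * t^2 - 48 * t^5)) t := by
    have hb : HasDerivAt (fun t : ℝ => 1 + 20 * t^3 - 8 * t^6) (60 * t^2 - 48 * t^5) t := by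
      have := (((hasDerivAt_pow 3 t).const_mul (20:ℝ)).const_add 1).sub
        ((hasDerivAt_pow 6 t).const_mul (8:ℝ))
      convert! this using 1
      norm_num; ring
    convert! hb.pow 2 using 1
    norm_num
  have := hn.div hd (by positivity)
  convert! this using 1
  field_simp
  ring

lemma phi_mono : StrictMonoOn phi (Icc 0 (1/2)) := by
  apply strictMonoOn_of_deriv_pos (convex_Icc _ _)
  · intro t ht
    exact (phi_deriv ht.1 ht.2).continuousAt.continuousWithinAt
  · intro t ht
    rw [interior_Icc] at ht
    rw [(phi_deriv ht.1.le ht.2.le).deriv]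
    have := aux_W ht.1.le ht.2.le
    have := aux_C ht.1.le ht.2
    have := ht.1
    positivity

lemma phi_zero : phi 0 = 0 := by norm_num [phi]
lemma phi_half : phi (1/2) = 1 := by norm_num [phi]

lemma phi_image : phi '' Ioo 0 (1/2) = Ioo 0 1 := by
  apply Subset.antisymm
  · rintro _ ⟨t, ht, rfl⟩
    constructor
    · rw [← phi_zero]
      exact phi_mono (by norm_num) (Ioo_subset_Icc_self ht) ht.1
    · rw [← phi_half]
      exact phi_mono (Ioo_subset_Icc_self ht) (by norm_num) ht.2
  · have := intermediate_value_Ioo (f := phi) (a := 0) (b := 1/2) (by norm_num)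
      (fun t ht => (phi_deriv ht.1 ht.2).continuousAt.continuousWithinAt)
    rwa [phi_zero, phi_half] at this

lemma phi_key {t : ℝ} (h0 : 0 < t) (h1 : t < 1/2) :
    (192 * t^2 * (1+t^3)^2 * (1 - 8 * t^3)^2 / (1 + 20 * t^3 - 8 * t^6)^3) *
      ((phi t) ^ (-(5:ℝ)/6) * (1 - phi t) ^ (-(2:ℝ)/3))
    = 6 * (t ^ (-(1:ℝ)/2) / √(1 + t^3)) := by
  have hW := aux_W h0.le h1.le
  have hC := aux_C h0.le h1
  have h1p : phi t = (4 * t * (1 + t^3))^3 / (1 + 20 * t^3 - 8 * t^6)^2 := rfl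
  have h2p : 1 - phi t = (1 - 8 * t^3)^3 / (1 + 20 * t^3 - 8 * t^6)^2 := by
    have hW2 := (pow_pos hW 2).ne'
    rw [h1p, eq_div_iff hW2, sub_mul, div_mul_cancel₀ _ hW2]; ring
  rw [h2p, h1p]
  have hB : 0 < 1 + t^3 := by positivity
  generalize 1 + 20 * t^3 - 8 * t^6 = W at *
  generalize 1 - 8 * t^3 = C at *
  generalize 1 + t^3 = B at *
  have hA : 0 < 4 * t * B := by positivity
  have p1 : ((4 * t * B)^3 / W^2) ^ (-(5:ℝ)/6) = (4*t*B) ^ (-(5:ℝ)/2) * W ^ ((5:ℝ)/3) := by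
    rw [Real.div_rpow (by positivity) (by positivity), ← Real.rpow_natCast, ← Real.rpow_natCast,
      ← Real.rpow_mul hA.le, ← Real.rpow_mul hW.le, div_eq_mul_inv, ← Real.rpow_neg hW.le]
    norm_num
  have p2 : (C^3 / W^2) ^ (-(2:ℝ)/3) = (C^2)⁻¹ * W ^ ((4:ℝ)/3) := by
    rw [Real.div_rpow (by positivity) (by positivity), ← Real.rpow_natCast, ← Real.rpow_natCast,
      ← Real.rpow_mul hC.le, ← Real.rpow_mul hW.le, div_eq_mul_inv, ← Real.rpow_neg hW.le,
      ← Real.rpow_natCast, ← Real.rpow_neg hC.le]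
    norm_num
  have p3 : W ^ ((5:ℝ)/3) * W ^ ((4:ℝ)/3) = W^3 := by
    rw [← Real.rpow_add hW, ← Real.rpow_natCast]; norm_num
  have q : ∀ x : ℝ, 0 < x → x ^ (-(5:ℝ)/2) = x ^ (-(1:ℝ)/2) / x^2 := by
    intro x hx
    rw [← Real.rpow_natCast, ← Real.rpow_sub hx]; norm_num
  have q2 : ∀ x : ℝ, 0 < x → x ^ (-(1:ℝ)/2) = (√x)⁻¹ := by
    intro x hx
    rw [Real.sqrt_eq_rpow, ← Real.rpow_neg hx.le]; norm_num
  have s4 : √(4:ℝ) = 2 := by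
    rw [show (4:ℝ) = 2^2 by norm_num]; exact Real.sqrt_sq (by norm_num)
  have p4 : (4*t*B) ^ (-(5:ℝ)/2) = t ^ (-(1:ℝ)/2) / √B / (2 * 16 * t^2 * B^2) := by
    rw [q _ hA, q2 _ hA, q2 _ h0, Real.sqrt_mul (by positivity), Real.sqrt_mul (by positivity), s4]
    have := Real.sqrt_pos.2 h0
    have := Real.sqrt_pos.2 hB
    field_simp
    norm_num
  rw [p1, p2, p4]
  have := Real.sqrt_pos.2 hB
  calc _ = 192 * t^2 * B^2 * C^2 / W^3 * (t ^ (-(1:ℝ)/2) / √B / (2 * 16 * t^2 * B^2) * (C^2)⁻¹ * (W ^ ((5:ℝ)/3) * W ^ ((4:ℝ)/3))) := by ring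
    _ = _ := by
      rw [p3]; field_simp; norm_num

lemma aux_main : ∫ t in (0:ℝ)..(1/2), t ^ (-(1:ℝ)/2) / √(1 + t^3)
    = (2:ℝ) ^ ((2:ℝ)/3) * Real.sqrt 3 * (Real.Gamma (1 / 3)) ^ 3 / (12 * Real.pi) := by
  have h := integral_image_eq_integral_deriv_smul_of_monotoneOn (f := phi) (s := Ioo 0 (1/2))
    measurableSet_Ioo
    (fun t ht => (phi_deriv ht.1.le ht.2.le).hasDerivWithinAt)
    (phi_mono.monotoneOn.mono Ioo_subset_Icc_self)
    (fun x : ℝ => x ^ (-(5:ℝ)/6) * (1 - x) ^ (-(2:ℝ)/3))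
  rw [phi_image, aux_beta, aux_gamma] at h
  rw [setIntegral_congr_fun (g := fun t => 6 * (t ^ (-(1:ℝ)/2) / √(1 + t^3))) measurableSet_Ioo
    (fun t ht => by simpa only [smul_eq_mul] using phi_key ht.1 ht.2), integral_const_mul] at h
  rw [intervalIntegral.integral_of_le (by norm_num), integral_Ioc_eq_integral_Ioo]
  have hpi := Real.pi_pos
  field_simp at h ⊢
  linarith

lemma aux_int (r : ℝ) (hr : -1 < r) :
    IntervalIntegrable (fun t : ℝ => t ^ r / √(1 + t^3)) volume 0 (1/2) := by
  simp_rw [div_eq_mul_inv]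
  apply (intervalIntegral.intervalIntegrable_rpow' hr).mul_continuousOn
  apply ContinuousOn.inv₀
  · fun_prop
  · intro t ht
    rw [uIcc_of_le (by norm_num)] at ht
    have := ht.1
    positivity

lemma aux_ftc : ∫ t in (0:ℝ)..(1/2),
    (2 * (t ^ ((5:ℝ)/2) / √(1+t^3)) + 1/2 * (t ^ (-(1:ℝ)/2) / √(1 + t^3))) = 3/4 := by
  rw [intervalIntegral.integral_eq_sub_of_hasDerivAt_of_le (f := fun t => √t * √(1+t^3))
    (by norm_num) (by fun_prop)]
  · rw [← Real.sqrt_mul (by norm_num)]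
    norm_num
  · intro t ht
    have h0 := ht.1
    have hB : 0 < 1 + t^3 := by positivity
    have d1 := Real.hasDerivAt_sqrt h0.ne'
    have d2 := ((hasDerivAt_pow 3 t).const_add 1).sqrt hB.ne'
    convert! d1.mul d2 using 1
    have e1 : t ^ (-(1:ℝ)/2) = (√t)⁻¹ := by
      rw [Real.sqrt_eq_rpow, ← Real.rpow_neg h0.le]; norm_num
    have e2 : t ^ ((5:ℝ)/2) = t^2 * √t := by
      rw [Real.sqrt_eq_rpow, ← Real.rpow_natCast, ← Real.rpow_add h0]; norm_num
    rw [e1, e2]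
    have s1 := Real.sqrt_pos.2 h0
    have s2 := Real.sqrt_pos.2 hB
    have k1 := Real.sq_sqrt h0.le
    have k2 := Real.sq_sqrt hB.le
    field_simp
    rw [k1, k2]
    norm_num
    ring
  · exact ((aux_int _ (by norm_num)).const_mul 2).add ((aux_int _ (by norm_num)).const_mul _)

theorem integral_identity :
    (∫ t in (0 : ℝ)..(1 / 2 : ℝ),
        (2 * t ^ ((5 : ℝ) / 2) - t ^ (-(1 : ℝ) / 2)) / Real.sqrt (1 + t ^ 3))
      = 3 / 4 - (2 : ℝ) ^ ((2 : ℝ) / 3) * Real.sqrt 3 * (Real.Gamma (1 / 3)) ^ 3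
          / (8 * Real.pi) := by
  have e : ∀ t : ℝ, (2 * t ^ ((5 : ℝ) / 2) - t ^ (-(1 : ℝ) / 2)) / Real.sqrt (1 + t ^ 3)
      = (2 * (t ^ ((5:ℝ)/2) / √(1+t^3)) + 1/2 * (t ^ (-(1:ℝ)/2) / √(1 + t^3)))
        - 3/2 * (t ^ (-(1:ℝ)/2) / √(1 + t^3)) := by
    intro t; ring
  simp_rw [e]
  rw [intervalIntegral.integral_sub
    (((aux_int _ (by norm_num)).const_mul 2).add ((aux_int _ (by norm_num)).const_mul _))
    ((aux_int _ (by norm_num)).const_mul _), aux_ftc, intervalIntegral.integral_const_mul, aux_main]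
  have hpi := Real.pi_pos
  field_simp
  ring
end

section
/- As $x \to \infty$, $\sum_{1 \le n \le x} \varrho(n) \sim \frac{2^{2/3}\sqrt{3}\,\Gamma\left(\frac{1}{3}\right)^3}{4\pi}\, x^{2/3}$. -/
open Filter Asymptotics

/-- `varrho n` is the number of pairs `(j, k)` of positive integers with
`j * k * (j + k) / 2 = n`, i.e. with `j * k * (j + k) = 2 * n`. -/
noncomputable def varrho (n : ℕ) : ℕ :=
  Nat.card {p : ℕ × ℕ // 0 < p.1 ∧ 0 < p.2 ∧ p.1 * p.2 * (p.1 + p.2) = 2 * n}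

open MeasureTheory Set Topology

def regR : Set (ℝ × ℝ) := {p | 0 < p.1 ∧ 0 < p.2 ∧ p.1 * p.2 * (p.1 + p.2) ≤ 1}

def regC : Set (ℝ × ℝ) := {p | 0 < p.1 ∧ 0 < p.2 ∧ p.1 * p.2 * (p.1 + p.2) = 1}

def regD : Set (ℝ × ℝ) := {p | 0 < p.2 ∧ p.2 < 1 ∧ p.1 ^ 3 * (p.2 * (1 - p.2)) ≤ 1}

def regQ : Set (ℝ × ℝ) := {p | 0 < p.1 ∧ p.1 < p.2 ∧ p.1 * (p.2 - p.1) * p.2 ≤ 1}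

lemma meas_regR : MeasurableSet regR := by
  unfold regR; measurability

lemma meas_regC : MeasurableSet regC := by
  unfold regC; measurability

lemma meas_regD : MeasurableSet regD := by
  unfold regD
  refine MeasurableSet.inter (s₁ := {p : ℝ × ℝ | 0 < p.2}) (measurableSet_lt (by fun_prop) (by fun_prop))
    (MeasurableSet.inter (s₁ := {p : ℝ × ℝ | p.2 < 1}) (s₂ := {p : ℝ × ℝ | p.1 ^ 3 * (p.2 * (1 - p.2)) ≤ 1})
      (measurableSet_lt (by fun_prop) (by fun_prop))
      (measurableSet_le (by fun_prop) (by fun_prop)))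

lemma meas_regQ : MeasurableSet regQ := by
  unfold regQ
  refine MeasurableSet.inter (s₁ := {p : ℝ × ℝ | 0 < p.1}) (measurableSet_lt (by fun_prop) (by fun_prop))
    (MeasurableSet.inter (s₁ := {p : ℝ × ℝ | p.1 < p.2}) (s₂ := {p : ℝ × ℝ | p.1 * (p.2 - p.1) * p.2 ≤ 1})
      (measurableSet_lt (by fun_prop) (by fun_prop))
      (measurableSet_le (by fun_prop) (by fun_prop)))

lemma vol_regC : volume regC = 0 := by
  rw [Measure.volume_eq_prod, Measure.measure_prod_null meas_regC]
  refine Filter.Eventually.of_forall fun u => ?_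
  refine Set.Subsingleton.measure_zero ?_ _
  rintro v ⟨hu, hv, h⟩ w ⟨_, hw, h'⟩
  simp only at *
  by_contra hne
  have : u * (v - w) * (u + v + w) = 0 := by linear_combination h - h'
  have h3 : v - w ≠ 0 := sub_ne_zero.2 hne
  have : u * (v - w) * (u + v + w) ≠ 0 := by positivity
  contradiction

lemma beta_lint : ∫⁻ s in Ioo (0:ℝ) 1, ENNReal.ofReal ((s * (1 - s)) ^ (-(2/3) : ℝ))
    = ENNReal.ofReal (ProbabilityTheory.beta (1/3) (1/3)) := by
  have hb : 0 < ProbabilityTheory.beta (1/3) (1/3) :=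
    ProbabilityTheory.beta_pos (by norm_num) (by norm_num)
  have h := ProbabilityTheory.lintegral_betaPDF_eq_one (α := 1/3) (β := 1/3)
    (by norm_num) (by norm_num)
  rw [ProbabilityTheory.lintegral_betaPDF] at h
  calc _ = ∫⁻ s in Ioo (0:ℝ) 1, ENNReal.ofReal (ProbabilityTheory.beta (1/3) (1/3)) *
        ENNReal.ofReal (1 / ProbabilityTheory.beta (1/3) (1/3) * s ^ ((1/3:ℝ) - 1)
          * (1 - s) ^ ((1/3:ℝ) - 1)) := by
        refine setLIntegral_congr_fun measurableSet_Ioo fun s hs => ?_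
        rw [← ENNReal.ofReal_mul hb.le, Real.mul_rpow hs.1.le (by linarith [hs.2])]
        congr 1
        norm_num
        field_simp
    _ = _ := by
        rw [lintegral_const_mul' _ _ ENNReal.ofReal_ne_top, h, mul_one]

lemma inner_lint (a : ℝ) (ha : 0 < a) :
    ∫⁻ r : ℝ, ENNReal.ofReal r * ({r : ℝ | r ^ 3 * a ≤ 1}.indicator 1 r) =
      ENNReal.ofReal (1/2) * ENNReal.ofReal (a ^ (-(2/3) : ℝ)) := by
  set c : ℝ := a ^ (-(1/3) : ℝ) with hc
  have hc0 : 0 < c := Real.rpow_pos_of_pos ha _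
  have hc3 : c ^ 3 * a = 1 := by
    rw [hc, ← Real.rpow_natCast, ← Real.rpow_mul ha.le]
    norm_num
    rw [Real.rpow_neg_one]; field_simp
  have hc2 : c ^ 2 = a ^ (-(2/3) : ℝ) := by
    rw [hc, ← Real.rpow_natCast, ← Real.rpow_mul ha.le]
    norm_num
  have : ∀ r : ℝ, ENNReal.ofReal r * ({r : ℝ | r ^ 3 * a ≤ 1}.indicator 1 r) =
      (Ioc 0 c).indicator (fun r => ENNReal.ofReal r) r := by
    intro r
    rcases le_or_gt r 0 with hr | hr
    · rw [ENNReal.ofReal_of_nonpos hr, zero_mul, indicator_of_notMem]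
      simp [hr.not_gt]
    · have : r ^ 3 * a ≤ 1 ↔ r ≤ c := by
        rw [← hc3, mul_le_mul_iff_left₀ ha]
        exact pow_le_pow_iff_left₀ hr.le hc0.le (by norm_num)
      by_cases h : r ≤ c
      · rw [indicator_of_mem (by simpa using this.2 h), indicator_of_mem (show r ∈ Ioc 0 c from ⟨hr, h⟩)]; simp
      · rw [indicator_of_notMem (show r ∉ {r : ℝ | r ^ 3 * a ≤ 1} from fun h1 => h (this.1 h1)), indicator_of_notMem (fun h' => h h'.2)]; simp
  simp_rw [this]
  rw [lintegral_indicator measurableSet_Ioc, ← ofReal_integral_eq_lintegral_ofReal,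
    ← intervalIntegral.integral_of_le hc0.le, integral_id, ← hc2, ← ENNReal.ofReal_mul (by norm_num)]
  · congr 1; ring
  · exact (continuous_id.integrableOn_Icc).mono_set Ioc_subset_Icc_self
  · exact (ae_restrict_iff' measurableSet_Ioc).2 (Filter.Eventually.of_forall fun r hr => hr.1.le)

lemma slice (r : ℝ) : volume ((fun u => (u, r)) ⁻¹' regQ) =
    ENNReal.ofReal r * volume (Prod.mk r ⁻¹' regD) := by
  rcases le_or_gt r 0 with hr | hr
  · rw [ENNReal.ofReal_of_nonpos hr, zero_mul]
    convert measure_empty (μ := volume)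
    ext u
    simp only [regQ, mem_preimage, mem_ofPred_eq, mem_empty_iff_false, iff_false]
    rintro ⟨h1, h2, _⟩; linarith
  · have : Prod.mk r ⁻¹' regD = (r * ·) ⁻¹' ((fun u => (u, r)) ⁻¹' regQ) := by
      ext s
      simp only [regQ, regD, mem_preimage, mem_ofPred_eq]
      refine and_congr (by simp [hr]) (and_congr (by simp [hr]) ?_)
      ring_nf
    rw [this, Real.volume_preimage_mul_left hr.ne', ← mul_assoc, ← ENNReal.ofReal_mul hr.le,
      abs_of_pos (by positivity), mul_inv_cancel₀ hr.ne']
    simp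

lemma vol_regR : volume regR = ENNReal.ofReal (ProbabilityTheory.beta (1/3) (1/3) / 2) := by
  have h1 : regR = (fun z : ℝ × ℝ => (z.1, z.1 + z.2)) ⁻¹' regQ := by
    ext ⟨u, v⟩
    simp [regR, regQ]
  have h2 : volume regR = volume regQ := by
    rw [h1]
    exact (measurePreserving_prod_add (volume : Measure ℝ) volume).measure_preimage
      meas_regQ.nullMeasurableSet
  rw [h2, Measure.volume_eq_prod, Measure.prod_apply_symm meas_regQ]
  simp_rw [slice]
  have h3 : ∀ r : ℝ, ENNReal.ofReal r * volume (Prod.mk r ⁻¹' regD) =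
      ∫⁻ s : ℝ, ENNReal.ofReal r * regD.indicator 1 (r, s) := by
    intro r
    rw [lintegral_const_mul' _ _ ENNReal.ofReal_ne_top, ← lintegral_indicator_one
      (measurable_prodMk_left meas_regD)]
    rfl
  simp_rw [h3]
  rw [lintegral_lintegral_swap]
  · have h4 : ∀ s : ℝ, ∫⁻ r : ℝ, ENNReal.ofReal r * regD.indicator 1 (r, s) =
      (Ioo (0:ℝ) 1).indicator (fun s => ENNReal.ofReal (1/2) *
        ENNReal.ofReal ((s * (1 - s)) ^ (-(2/3) : ℝ))) s := by
      intro s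
      by_cases hs : s ∈ Ioo (0:ℝ) 1
      · rw [indicator_of_mem hs, ← inner_lint _ (mul_pos hs.1 (by linarith [hs.2]))]
        congr 1; ext r; congr 1
        have := hs.1
        have := hs.2
        simp [indicator, regD, *]
      · rw [indicator_of_notMem hs]
        have : ∀ r, (r, s) ∉ regD := fun r h => hs ⟨h.1, h.2.1⟩
        simp [this]
    simp_rw [h4]
    rw [lintegral_indicator measurableSet_Ioo, lintegral_const_mul' _ _ ENNReal.ofReal_ne_top,
      beta_lint, ← ENNReal.ofReal_mul (by norm_num)]
    congr 1; ring
  · apply Measurable.aemeasurable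
    have : Measurable (regD.indicator (1 : ℝ × ℝ → ENNReal)) :=
      measurable_one.indicator meas_regD
    simp only [Function.uncurry_def]
    fun_prop

lemma beta_val : ProbabilityTheory.beta (1/3) (1/3) / 2 =
    Real.sqrt 3 * (Real.Gamma (1 / 3)) ^ 3 / (4 * Real.pi) := by
  have h := Real.Gamma_mul_Gamma_one_sub (1/3)
  have hs : Real.sin (Real.pi * (1/3)) = Real.sqrt 3 / 2 := by
    rw [← Real.sin_pi_div_three]; congr 1; ring
  rw [hs] at h
  norm_num at h
  have h1 : 0 < Real.Gamma (1/3) := Real.Gamma_pos_of_pos (by norm_num)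
  have h2 : 0 < Real.Gamma (2/3) := Real.Gamma_pos_of_pos (by norm_num)
  have h3 : (0:ℝ) < Real.sqrt 3 := by positivity
  have hp := Real.pi_pos
  unfold ProbabilityTheory.beta
  norm_num
  rw [div_div, div_eq_div_iff (by positivity) (by positivity)]
  field_simp at h
  norm_num at h
  linear_combination (-2 * Real.Gamma (1/3) ^ 2) * h

def gS (x : ℝ) : Set (ℝ × ℝ) := {p | 0 < p.1 ∧ 0 < p.2 ∧
  (⌈p.1⌉₊ : ℝ) * ⌈p.2⌉₊ * (⌈p.1⌉₊ + ⌈p.2⌉₊) ≤ 2 * x}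

lemma meas_gS (x : ℝ) : MeasurableSet (gS x) := by
  unfold gS
  have h1 : Measurable fun p : ℝ × ℝ => (⌈p.1⌉₊ : ℝ) :=
    measurable_from_nat.comp (Nat.measurable_ceil.comp measurable_fst)
  have h2 : Measurable fun p : ℝ × ℝ => (⌈p.2⌉₊ : ℝ) :=
    measurable_from_nat.comp (Nat.measurable_ceil.comp measurable_snd)
  refine MeasurableSet.inter (s₁ := {p : ℝ × ℝ | 0 < p.1}) (measurableSet_lt (by fun_prop) (by fun_prop))
    (MeasurableSet.inter (s₁ := {p : ℝ × ℝ | 0 < p.2}) (s₂ := {p : ℝ × ℝ | (⌈p.1⌉₊ : ℝ) * ⌈p.2⌉₊ * (⌈p.1⌉₊ + ⌈p.2⌉₊) ≤ 2 * x})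
      (measurableSet_lt (by fun_prop) (by fun_prop))
      (measurableSet_le (by fun_prop) (by fun_prop)))

def gP (m : ℕ) : Finset (ℕ × ℕ) :=
  (Finset.range (2 * m + 1) ×ˢ Finset.range (2 * m + 1)).filter
    fun p => 0 < p.1 ∧ 0 < p.2 ∧ p.1 * p.2 * (p.1 + p.2) ≤ 2 * m

lemma mem_gP (m : ℕ) (p : ℕ × ℕ) : p ∈ gP m ↔
    0 < p.1 ∧ 0 < p.2 ∧ p.1 * p.2 * (p.1 + p.2) ≤ 2 * m := by
  simp only [gP, Finset.mem_filter, Finset.mem_product, Finset.mem_range, and_iff_right_iff_imp]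
  rintro ⟨h1, h2, h3⟩
  obtain ⟨a, b⟩ := p
  simp only at *
  have : a ≤ a * b * (a + b) := by nlinarith [Nat.mul_pos h1 h2]
  have : b ≤ a * b * (a + b) := by nlinarith [Nat.mul_pos h1 h2]
  omega

lemma sum_varrho (m : ℕ) : ∑ n ∈ Finset.Icc 1 m, varrho n = (gP m).card := by
  rw [Finset.card_eq_sum_card_fiberwise (f := fun p => p.1 * p.2 * (p.1 + p.2) / 2)
    (t := Finset.Icc 1 m)]
  · refine Finset.sum_congr rfl fun n hn => ?_
    rw [Finset.mem_Icc] at hn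
    unfold varrho
    rw [Nat.subtype_card]
    rintro ⟨a, b⟩
    rw [Finset.mem_filter, mem_gP]
    have hev : 2 ∣ a * b * (a + b) := by
      rw [← even_iff_two_dvd]
      rcases Nat.even_or_odd a with h | h <;> rcases Nat.even_or_odd b with h' | h' <;>
        simp_all [Nat.even_add, Nat.even_mul, ← Nat.not_even_iff_odd]
    constructor
    · rintro ⟨⟨h1, h2, h3⟩, h4⟩
      simp only at *
      refine ⟨h1, h2, by omega⟩
    · rintro ⟨h1, h2, h3⟩
      simp only at *
      refine ⟨⟨h1, h2, by omega⟩, by omega⟩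
  · rintro ⟨a, b⟩ h
    rw [Finset.mem_coe, mem_gP] at h
    obtain ⟨h1, h2, h3⟩ := h
    simp only [Finset.coe_Icc, Set.mem_Icc] at *
    have : 1 ≤ a * b := Nat.mul_pos h1 h2
    have : 2 ≤ a * b * (a + b) := by nlinarith
    omega

lemma vol_gS (x : ℝ) (hx : 0 ≤ x) : volume (gS x) = ((gP ⌊x⌋₊).card : ENNReal) := by
  have key : gS x = ⋃ p ∈ gP ⌊x⌋₊,
      (Ioc ((p.1 : ℝ) - 1) p.1) ×ˢ (Ioc ((p.2 : ℝ) - 1) p.2) := by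
    have hc : ∀ (u : ℝ) (n : ℕ), 0 < n → (u ∈ Ioc ((n : ℝ) - 1) n ↔ ⌈u⌉₊ = n) := by
      intro u n hn
      rw [Nat.ceil_eq_iff hn.ne', Nat.cast_sub hn]; simp
    have hev : ∀ a b : ℕ, ((a : ℝ) * b * (a + b) ≤ 2 * x ↔ a * b * (a + b) ≤ 2 * ⌊x⌋₊) := by
      intro a b
      have hev : 2 ∣ a * b * (a + b) := by
        rw [← even_iff_two_dvd]
        rcases Nat.even_or_odd a with h | h <;> rcases Nat.even_or_odd b with h' | h' <;>
          simp_all [Nat.even_add, Nat.even_mul, ← Nat.not_even_iff_odd]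
      obtain ⟨c, hcc⟩ := hev
      have : (a : ℝ) * b * (a + b) = 2 * c := by exact_mod_cast hcc
      rw [this, hcc, Nat.mul_le_mul_left_iff (by norm_num), Nat.le_floor_iff hx]
      constructor <;> intro h <;> linarith
    ext ⟨u, v⟩
    simp only [mem_iUnion, mem_prod, exists_prop, mem_gP, gS, mem_ofPred_eq]
    constructor
    · rintro ⟨h1, h2, h3⟩
      have h1' := Nat.ceil_pos.2 h1
      have h2' := Nat.ceil_pos.2 h2
      exact ⟨(⌈u⌉₊, ⌈v⌉₊), ⟨h1', h2', (hev _ _).1 h3⟩, (hc _ _ h1').2 rfl, (hc _ _ h2').2 rfl⟩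
    · rintro ⟨⟨a, b⟩, ⟨h1, h2, h3⟩, h4, h5⟩
      simp only at *
      rw [hc _ _ h1] at h4
      rw [hc _ _ h2] at h5
      subst h4 h5
      exact ⟨Nat.ceil_pos.1 h1, Nat.ceil_pos.1 h2, (hev _ _).2 h3⟩
  rw [key, measure_biUnion_finset]
  · simp [Measure.volume_eq_prod, Measure.prod_prod]
  · rintro ⟨a, b⟩ hab ⟨c, d⟩ hcd hne
    rw [Function.onFun, Set.disjoint_left]
    rintro ⟨u, v⟩ ⟨⟨h1, h2⟩, h3, h4⟩ ⟨⟨h5, h6⟩, h7, h8⟩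
    simp only at *
    apply hne
    have e1 : (a : ℝ) < c + 1 := by linarith
    have e2 : (c : ℝ) < a + 1 := by linarith
    have e3 : (b : ℝ) < d + 1 := by linarith
    have e4 : (d : ℝ) < b + 1 := by linarith
    norm_cast at e1 e2 e3 e4
    ext <;> simp <;> omega
  · intro p _
    exact measurableSet_Ioc.prod measurableSet_Ioc

lemma rpow_third_cube (y : ℝ) (hy : 0 ≤ y) : (y ^ (1/3 : ℝ)) ^ 3 = y := by
  rw [← Real.rpow_natCast, ← Real.rpow_mul hy]; norm_num

lemma tendsto_vol :
    Tendsto (fun x : ℝ => volume (((2 * x) ^ (1/3 : ℝ) • ·) ⁻¹' gS x)) atTop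
      (𝓝 (volume regR)) := by
  have hsub : ∀ x : ℝ, 0 < x → ((2 * x) ^ (1/3 : ℝ) • ·) ⁻¹' gS x ⊆ regR := by
    rintro x hx ⟨u, v⟩ ⟨h1, h2, h3⟩
    have hr : 0 < (2 * x) ^ (1/3 : ℝ) := by positivity
    have hr3 := rpow_third_cube (2 * x) (by positivity)
    set r := (2 * x) ^ (1/3 : ℝ)
    simp only [Prod.smul_mk, smul_eq_mul] at h1 h2 h3
    have hu : 0 < u := pos_of_mul_pos_right h1 hr.le
    have hv : 0 < v := pos_of_mul_pos_right h2 hr.le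
    refine ⟨hu, hv, ?_⟩
    have h4 : (r * u) * (r * v) * (r * u + r * v) ≤ r ^ 3 := by
      rw [hr3]
      refine le_trans ?_ h3
      have := Nat.le_ceil (r * u)
      have := Nat.le_ceil (r * v)
      gcongr
    have h5 : r ^ 3 * (u * v * (u + v)) ≤ r ^ 3 * 1 := by linarith
    exact le_of_mul_le_mul_left h5 (by positivity)
  refine tendsto_measure_of_ae_tendsto_indicator atTop meas_regR
    (fun x => measurable_const_smul _ (meas_gS x)) meas_regR ?_ ?_ ?_
  · rw [vol_regR]; exact ENNReal.ofReal_ne_top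
  · filter_upwards [eventually_gt_atTop 0] with x hx using hsub x hx
  · have hC : ∀ᵐ p : ℝ × ℝ, p ∉ regC := measure_eq_zero_iff_ae_notMem.1 vol_regC
    filter_upwards [hC] with p hp
    by_cases hR : p ∈ regR
    · obtain ⟨u, v⟩ := p
      obtain ⟨hu, hv, h⟩ := hR
      simp only at hu hv h
      have hlt : u * v * (u + v) < 1 := lt_of_le_of_ne h fun h' => hp ⟨hu, hv, h'⟩
      have hrt : Tendsto (fun x : ℝ => (2 * x) ^ (1/3 : ℝ)) atTop atTop :=
        (tendsto_rpow_atTop (by norm_num)).comp (tendsto_id.const_mul_atTop (by norm_num))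
      have hcu : ∀ w : ℝ, 0 < w → Tendsto (fun r : ℝ => (⌈r * w⌉₊ : ℝ) / r) atTop (𝓝 w) := by
        intro w hw
        simpa [mul_comm] using tendsto_nat_ceil_mul_div_atTop (R := ℝ) hw.le
      have ht := (((hcu u hu).mul (hcu v hv)).mul ((hcu u hu).add (hcu v hv))).comp hrt
      filter_upwards [ht.eventually_lt_const hlt, eventually_gt_atTop 0] with x hx hx0
      refine iff_of_true ?_ ⟨hu, hv, h⟩
      have hr : 0 < (2 * x) ^ (1/3 : ℝ) := by positivity
      have hr3 := rpow_third_cube (2 * x) (by positivity)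
      simp only [Function.comp_apply] at hx
      simp only [mem_preimage, gS, mem_ofPred_eq, Prod.smul_mk, smul_eq_mul]
      generalize (2 * x) ^ (1/3 : ℝ) = r at *
      refine ⟨by positivity, by positivity, ?_⟩
      rw [← hr3]
      generalize (⌈r * u⌉₊ : ℝ) = a at *
      generalize (⌈r * v⌉₊ : ℝ) = b at *
      have : a / r * (b / r) * (a / r + b / r) = a * b * (a + b) / r ^ 3 := by field_simp
      rw [this, div_lt_one (by positivity)] at hx
      exact hx.le
    · filter_upwards [eventually_gt_atTop 0] with x hx
      exact iff_of_false (fun h => hR (hsub x hx h)) hR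

theorem summatory_varrho_main_term :
    (fun x : ℝ => ∑ n ∈ Finset.Icc 1 ⌊x⌋₊, (varrho n : ℝ)) ~[atTop]
      fun x : ℝ => (2 : ℝ) ^ ((2 : ℝ) / 3) * Real.sqrt 3 * (Real.Gamma (1 / 3)) ^ 3
        / (4 * Real.pi) * x ^ ((2 : ℝ) / 3) := by
  have hb : 0 < ProbabilityTheory.beta (1/3) (1/3) / 2 :=
    half_pos (ProbabilityTheory.beta_pos (by norm_num) (by norm_num))
  have ht := (ENNReal.tendsto_toReal (by rw [vol_regR]; exact ENNReal.ofReal_ne_top)).comp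
    tendsto_vol
  rw [vol_regR, ENNReal.toReal_ofReal hb.le] at ht
  have he := ((isEquivalent_const_iff_tendsto hb.ne').2 ht).mul
    (IsEquivalent.refl (u := fun x : ℝ => (2 : ℝ) ^ ((2 : ℝ) / 3) * x ^ ((2 : ℝ) / 3)) (l := atTop))
  refine (he.congr_left ?_).congr_right ?_
  · filter_upwards [eventually_gt_atTop 0] with x hx
    have hr : 0 < (2 * x) ^ (1/3 : ℝ) := by positivity
    have hr2 : ((2 * x) ^ (1/3 : ℝ)) ^ 2 = (2 : ℝ) ^ ((2 : ℝ) / 3) * x ^ ((2 : ℝ) / 3) := by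
      rw [← Real.mul_rpow (by norm_num) hx.le, ← Real.rpow_natCast,
        ← Real.rpow_mul (by positivity)]
      norm_num
    simp only [Pi.mul_apply, Function.comp_apply]
    rw [← hr2, Measure.addHaar_preimage_smul _ hr.ne', vol_gS x hx.le, ← Nat.cast_sum, sum_varrho]
    simp only [Module.finrank_prod, Module.finrank_self]
    rw [ENNReal.toReal_mul, ENNReal.toReal_ofReal (abs_nonneg _), abs_of_pos (by positivity)]
    simp only [ENNReal.toReal_natCast]
    field_simp
  · refine Eventually.of_forall fun x => ?_
    simp only [Pi.mul_apply, Function.const_apply, beta_val]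
    ring
end
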